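/- arXiv:2308.00372 — 3 statements merged into one kernel-verified Lean document; each statement's English description precedes it below -/
import Mathlib

section
/- Let X be a complex Banach space and let ω ∈ ℝ^r be nonresonant, i.e. for α ∈ ℤ^r, α·ω = 0 implies α = 0. Let (φ̂_α)_{α∈ℤ^r} be a family in End(X) with Σ_{α∈ℤ^r} |φ̂_α| < ∞, and define φ : [0,∞) → End(X) by φ_τ = Σ_{α∈ℤ^r} e^{i(α·ω)τ} φ̂_α. If sup_{τ≥0} e^τ |φ_τ| < ∞, then φ̂_α = 0 for every α ∈ ℤ^r, and hence φ is identically zero. (Consequently, the spaces of quasi-periodic maps and of exponentially decaying continuous maps are in direct sum.) -/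
open scoped BigOperators
open Filter MeasureTheory

noncomputable section

variable {X : Type*} [NormedAddCommGroup X] [NormedSpace ℂ X] [CompleteSpace X]

/-- `|α| = |α₁| + ⋯ + |α_r|` for a multi-index `α ∈ ℤ^r`. -/
def absIdx {r : ℕ} (α : Fin r → ℤ) : ℝ := ∑ i, |(α i : ℝ)|

/-- `α · ω = α₁ω₁ + ⋯ + α_rω_r`. -/
def dotIdx {r : ℕ} (ω : Fin r → ℝ) (α : Fin r → ℤ) : ℝ := ∑ i, (α i : ℝ) * ω i

/-- The quasi-periodic ("sharp") map generated by a family of Fourier coefficients: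
`τ ↦ Σ_α e^{i(α·ω)τ} φ̂_α`. -/
def sharpSum {r : ℕ} (ω : Fin r → ℝ) (φhat : (Fin r → ℤ) → (X →L[ℂ] X)) (τ : ℝ) :
    X →L[ℂ] X :=
  ∑' α : Fin r → ℤ, Complex.exp (Complex.I * (dotIdx ω α : ℂ) * (τ : ℂ)) • φhat α

/-- The weighted ℓ¹-norm `Σ_α e^{κ|α|} ‖φ̂_α‖` of a family of Fourier coefficients. -/
def sharpNorm {r : ℕ} (κ : ℝ) (φhat : (Fin r → ℤ) → (X →L[ℂ] X)) : ℝ :=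
  ∑' α : Fin r → ℤ, Real.exp (κ * absIdx α) * ‖φhat α‖

/-- `sup_{τ ≥ 0} e^τ ‖φ♭_τ‖` for the exponentially decaying ("flat") part. -/
def flatSup (φflat : ℝ → (X →L[ℂ] X)) : ℝ :=
  ⨆ τ : Set.Ici (0:ℝ), Real.exp (τ : ℝ) * ‖φflat (τ : ℝ)‖

/-- The sharp-flat norm `𝒩_κ(φ) = Σ_α e^{κ|α|}‖φ̂_α‖ + sup_{τ≥0} e^τ‖φ♭_τ‖`. -/
def SFNorm {r : ℕ} (κ : ℝ) (φhat : (Fin r → ℤ) → (X →L[ℂ] X))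
    (φflat : ℝ → (X →L[ℂ] X)) : ℝ :=
  sharpNorm κ φhat + flatSup φflat

/-- `φ : [0,∞) → End(X)` is sharp-flat of class `κ`, with sharp Fourier coefficients
`φhat` and flat part `φflat`. -/
structure IsSharpFlat {r : ℕ} (ω : Fin r → ℝ) (κ : ℝ) (φ : ℝ → (X →L[ℂ] X))
    (φhat : (Fin r → ℤ) → (X →L[ℂ] X)) (φflat : ℝ → (X →L[ℂ] X)) : Prop where
  summable : Summable fun α : Fin r → ℤ => Real.exp (κ * absIdx α) * ‖φhat α‖
  flat_cont : ContinuousOn φflat (Set.Ici 0)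
  flat_bdd : BddAbove (Set.range fun τ : Set.Ici (0:ℝ) => Real.exp (τ : ℝ) * ‖φflat (τ : ℝ)‖)
  decomp : ∀ τ : ℝ, 0 ≤ τ → φ τ = sharpSum ω φhat τ + φflat τ

/-- The time average `⟨φ⟩ = lim_{T→∞} (1/T) ∫₀^T φ_σ dσ` equals `B`. -/
def HasTimeAvg {E : Type*} [NormedAddCommGroup E] [NormedSpace ℝ E] (φ : ℝ → E) (B : E) : Prop :=
  Tendsto (fun T : ℝ => (1 / T) • ∫ σ in (0:ℝ)..T, φ σ) atTop (nhds B)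

/-- The constant `c_I(κ) = max{1, (1/c_D)(ν/(κe))^ν}` from the integration lemma. -/
def cI (c_D ν κ : ℝ) : ℝ := max 1 ((1 / c_D) * (ν / (κ * Real.exp 1)) ^ ν)

/-- If a quasi-periodic map generated by a nonresonant frequency vector
`ω` and absolutely summable Fourier coefficients decays like `e^{-τ}` (in the sense that
`sup_{τ≥0} e^τ‖φ_τ‖ < ∞`), then all its Fourier coefficients vanish and the map is
identically zero on `[0,∞)`. -/
theorem quasiPeriodic_expDecay_eq_zero
    {r : ℕ} (hr : 1 ≤ r) (ω : Fin r → ℝ)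
    (hres : ∀ α : Fin r → ℤ, dotIdx ω α = 0 → α = 0)
    (φhat : (Fin r → ℤ) → (X →L[ℂ] X))
    (hsum : Summable fun α : Fin r → ℤ => ‖φhat α‖)
    (φ : ℝ → (X →L[ℂ] X))
    (hφ : ∀ τ : ℝ, 0 ≤ τ → φ τ = sharpSum ω φhat τ)
    (hdecay : ∃ S : ℝ, ∀ τ : ℝ, 0 ≤ τ → Real.exp τ * ‖φ τ‖ ≤ S) :
    (∀ α : Fin r → ℤ, φhat α = 0) ∧ (∀ τ : ℝ, 0 ≤ τ → φ τ = 0) := by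
  obtain ⟨S, hS⟩ := hdecay
  have hexpn : ∀ x y : ℝ, ‖Complex.exp (Complex.I * (x : ℂ) * (y : ℂ))‖ = 1 := by
    intro x y
    rw [Complex.norm_exp]
    simp
  have key : ∀ β : Fin r → ℤ, φhat β = 0 := by
    intro β
    -- rotated family
    set F : (Fin r → ℤ) → ℝ → (X →L[ℂ] X) := fun α τ =>
      Complex.exp (Complex.I * ((dotIdx ω α - dotIdx ω β : ℝ) : ℂ) * (τ : ℂ)) • φhat α with hF
    have hFn : ∀ α τ, ‖F α τ‖ = ‖φhat α‖ := by
      intro α τ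
      simp only [hF]
      rw [norm_smul, hexpn, one_mul]
    have hFc : ∀ α, Continuous (F α) := by
      intro α
      simp only [hF]
      fun_prop
    set G : ℝ → (X →L[ℂ] X) := fun τ => ∑' α, F α τ with hG
    have hFs : ∀ τ, HasSum (fun α => F α τ) (G τ) := by
      intro τ
      apply Summable.hasSum
      apply Summable.of_norm
      simpa only [hFn] using hsum
    have hGφ : ∀ τ, 0 ≤ τ → ‖G τ‖ = ‖φ τ‖ := by
      intro τ hτ
      have : G τ = Complex.exp (Complex.I * ((- dotIdx ω β : ℝ) : ℂ) * (τ : ℂ)) • φ τ := by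
        rw [hφ τ hτ, sharpSum, ← tsum_const_smul'']
        simp only [hG, hF]
        congr 1
        ext1 α
        rw [smul_smul, ← Complex.exp_add]
        congr 2
        push_cast
        ring
      rw [this, norm_smul, hexpn, one_mul]
    have hint : ∀ T : ℝ, HasSum (fun α => ∫ τ in (0:ℝ)..T, F α τ) (∫ τ in (0:ℝ)..T, G τ) := by
      intro T
      refine intervalIntegral.hasSum_integral_of_dominated_convergence
        (fun α _ => ‖φhat α‖) (fun α => (hFc α).aestronglyMeasurable) ?_ ?_ ?_ ?_
      · intro α
        exact Eventually.of_forall fun τ _ => (hFn α τ).le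
      · exact Eventually.of_forall fun τ _ => hsum
      · exact intervalIntegrable_const
      · exact Eventually.of_forall fun τ _ => hFs τ
    have hS0 : 0 ≤ S := le_trans (by positivity) (hS 0 le_rfl)
    -- the average tends to zero
    have hlim0 : Tendsto (fun T : ℝ => (T⁻¹ : ℝ) • ∫ τ in (0:ℝ)..T, G τ) atTop (nhds 0) := by
      have h1 : Tendsto (fun T : ℝ => T⁻¹ * S) atTop (nhds 0) := by
        simpa using tendsto_inv_atTop_zero.mul_const S
      refine squeeze_zero_norm' ?_ h1
      filter_upwards [eventually_gt_atTop (0:ℝ)] with T hT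
      rw [norm_smul, Real.norm_of_nonneg (inv_nonneg.2 hT.le)]
      refine mul_le_mul_of_nonneg_left ?_ (inv_nonneg.2 hT.le)
      have h2 : ‖∫ τ in (0:ℝ)..T, G τ‖ ≤ ∫ τ in (0:ℝ)..T, S * Real.exp (-τ) := by
        refine intervalIntegral.norm_integral_le_of_norm_le hT.le ?_ ?_
        · refine Eventually.of_forall fun τ hτ => ?_
          have h0 : 0 ≤ τ := hτ.1.le
          rw [hGφ τ h0, Real.exp_neg, ← div_eq_mul_inv, le_div_iff₀ (Real.exp_pos _), mul_comm]
          exact hS τ h0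
        · exact Continuous.intervalIntegrable (by fun_prop) _ _
      refine h2.trans ?_
      have h3 : (∫ τ in (0:ℝ)..T, Real.exp (-τ)) = 1 - Real.exp (-T) := by
        rw [intervalIntegral.integral_comp_neg (fun x => Real.exp x)]
        simp
      rw [intervalIntegral.integral_const_mul, h3]
      nlinarith [Real.exp_pos (-T)]
    -- the average tends to the coefficient
    have hlim1 : Tendsto (fun T : ℝ => ∑' α, (T⁻¹ : ℝ) • ∫ τ in (0:ℝ)..T, F α τ) atTop
        (nhds (∑' α, if α = β then φhat β else 0)) := by
      refine tendsto_tsum_of_dominated_convergence hsum ?_ ?_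
      · intro α
        by_cases hα : α = β
        · subst hα
          simp only [if_true]
          refine tendsto_const_nhds.congr' ?_
          filter_upwards [eventually_gt_atTop (0:ℝ)] with T hT
          simp [hF, smul_smul, hT.ne']
        · simp only [hα, if_false]
          have hne : dotIdx ω α - dotIdx ω β ≠ 0 := by
            intro h
            apply hα
            have h' : dotIdx ω (α - β) = 0 := by
              rw [← h]
              simp [dotIdx, sub_mul, Finset.sum_sub_distrib]
            exact sub_eq_zero.1 (hres _ h')
          set c : ℂ := Complex.I * ((dotIdx ω α - dotIdx ω β : ℝ) : ℂ) with hc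
          have hc0 : c ≠ 0 := mul_ne_zero Complex.I_ne_zero (by exact_mod_cast hne)
          have h1 : Tendsto (fun T : ℝ => T⁻¹ * (2 / ‖c‖ * ‖φhat α‖)) atTop (nhds 0) := by
            simpa using tendsto_inv_atTop_zero.mul_const (2 / ‖c‖ * ‖φhat α‖)
          refine squeeze_zero_norm' ?_ h1
          filter_upwards [eventually_gt_atTop (0:ℝ)] with T hT
          rw [norm_smul, Real.norm_of_nonneg (inv_nonneg.2 hT.le)]
          refine mul_le_mul_of_nonneg_left ?_ (inv_nonneg.2 hT.le)
          simp only [hF]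
          rw [intervalIntegral.integral_smul_const, norm_smul, integral_exp_mul_complex hc0,
            norm_div]
          gcongr
          refine (norm_sub_le _ _).trans ?_
          rw [hc, hexpn, hexpn]
          norm_num
      · filter_upwards [eventually_gt_atTop (0:ℝ)] with T hT α
        rw [norm_smul, Real.norm_of_nonneg (inv_nonneg.2 hT.le)]
        have h2 : ‖∫ τ in (0:ℝ)..T, F α τ‖ ≤ ‖φhat α‖ * |T - 0| :=
          intervalIntegral.norm_integral_le_of_norm_le_const fun τ _ => (hFn α τ).le
        rw [sub_zero, abs_of_pos hT] at h2
        rw [inv_mul_le_iff₀ hT, mul_comm]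
        exact h2
    rw [tsum_ite_eq] at hlim1
    have heq : (fun T : ℝ => ∑' α, (T⁻¹ : ℝ) • ∫ τ in (0:ℝ)..T, F α τ) =
        fun T : ℝ => (T⁻¹ : ℝ) • ∫ τ in (0:ℝ)..T, G τ := by
      ext1 T
      exact ((hint T).const_smul _).tsum_eq
    rw [heq] at hlim1
    exact tendsto_nhds_unique hlim1 hlim0
  refine ⟨key, fun τ hτ => ?_⟩
  rw [hφ τ hτ, sharpSum]
  simp [key]
end
end

section
/- Assume ω ∈ ℝ^r satisfies the Diophantine condition with constants c_D > 0 and ν > 0. Let 0 ≤ κ₋ < κ₊ and let ψ : [0,∞) → End(X) be sharp-flat of class κ₊ with time average ⟨ψ⟩. Let φ : [0,∞) → End(X) be a C¹ map with ∂_τ φ_τ = ψ_τ − ⟨ψ⟩ for all τ ≥ 0. Then φ is sharp-flat of class κ₋ (in particular its time average ⟨φ⟩ exists), and 𝒩_{κ₋}(φ − ⟨φ⟩) ≤ c_I(κ₊ − κ₋) · 𝒩_{κ₊}(ψ − ⟨ψ⟩), where c_I(κ) = max{1, (1/c_D)(ν/(κe))^ν}. -/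
open scoped BigOperators
open Filter MeasureTheory

noncomputable section

variable {X : Type*} [NormedAddCommGroup X] [NormedSpace ℂ X] [CompleteSpace X]

set_option maxHeartbeats 600000

lemma absIdx_nonneg {r : ℕ} (α : Fin r → ℤ) : 0 ≤ absIdx α :=
  Finset.sum_nonneg fun _ _ => abs_nonneg _

lemma absIdx_pos {r : ℕ} (α : Fin r → ℤ) (h : α ≠ 0) : 0 < absIdx α := by
  obtain ⟨i, hi⟩ := Function.ne_iff.1 h
  refine Finset.sum_pos' (fun _ _ => abs_nonneg _) ⟨i, Finset.mem_univ _, ?_⟩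
  simpa using hi

lemma norm_expIdx {r : ℕ} (ω : Fin r → ℝ) (α : Fin r → ℤ) (τ : ℝ) :
    ‖Complex.exp (Complex.I * (dotIdx ω α : ℂ) * (τ : ℂ))‖ = 1 := by
  have := Complex.norm_exp_I_mul_ofReal (dotIdx ω α * τ)
  rw [← this]; push_cast; ring_nf

lemma rpow_le_aux {ν δ x : ℝ} (hν : 0 < ν) (hδ : 0 < δ) (hx : 0 ≤ x) :
    x ^ ν ≤ (ν / (δ * Real.exp 1)) ^ ν * Real.exp (δ * x) := by
  have h1 : x ≤ ν / (δ * Real.exp 1) * Real.exp (δ * x / ν) := by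
    have h := Real.add_one_le_exp (δ * x / ν - 1)
    rw [Real.exp_sub] at h
    have h2 : δ * x / ν ≤ Real.exp (δ * x / ν) / Real.exp 1 := by linarith
    calc x = ν / δ * (δ * x / ν) := by field_simp
      _ ≤ ν / δ * (Real.exp (δ * x / ν) / Real.exp 1) := by gcongr
      _ = _ := by field_simp
  calc x ^ ν ≤ (ν / (δ * Real.exp 1) * Real.exp (δ * x / ν)) ^ ν :=
        Real.rpow_le_rpow hx h1 hν.le
    _ = _ := by
        rw [Real.mul_rpow (by positivity) (by positivity), ← Real.exp_mul]
        congr 2; field_simp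

lemma summable_of_weighted {r : ℕ} {κ : ℝ} (hκ : 0 ≤ κ) {f : (Fin r → ℤ) → (X →L[ℂ] X)}
    (h : Summable fun α : Fin r → ℤ => Real.exp (κ * absIdx α) * ‖f α‖) :
    Summable fun α => ‖f α‖ := by
  refine Summable.of_nonneg_of_le (fun _ => norm_nonneg _) (fun α => ?_) h
  have : 1 ≤ Real.exp (κ * absIdx α) := Real.one_le_exp (mul_nonneg hκ (absIdx_nonneg α))
  nlinarith [norm_nonneg (f α)]

lemma summable_sharp {r : ℕ} (ω : Fin r → ℝ) {f : (Fin r → ℤ) → (X →L[ℂ] X)}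
    (h : Summable fun α => ‖f α‖) (τ : ℝ) :
    Summable fun α => Complex.exp (Complex.I * (dotIdx ω α : ℂ) * (τ : ℂ)) • f α := by
  refine Summable.of_norm_bounded h (fun α => ?_)
  rw [norm_smul, norm_expIdx, one_mul]

lemma continuous_sharpSum {r : ℕ} (ω : Fin r → ℝ) {f : (Fin r → ℤ) → (X →L[ℂ] X)}
    (h : Summable fun α => ‖f α‖) : Continuous (sharpSum ω f) := by
  unfold sharpSum
  refine continuous_tsum (fun α => by fun_prop) h (fun α τ => ?_)
  rw [norm_smul, norm_expIdx, one_mul]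

/-- The flat part, bounded by an exponential, for `τ ≥ 0`. -/
lemma flat_le {g : ℝ → (X →L[ℂ] X)}
    (hb : BddAbove (Set.range fun τ : Set.Ici (0:ℝ) => Real.exp (τ : ℝ) * ‖g (τ : ℝ)‖))
    {τ : ℝ} (hτ : 0 ≤ τ) : ‖g τ‖ ≤ flatSup g * Real.exp (-τ) := by
  have := le_ciSup hb ⟨τ, hτ⟩
  rw [Real.exp_neg, ← div_eq_mul_inv, le_div_iff₀ (Real.exp_pos _), mul_comm]
  exact this

lemma flat_primitive {g : ℝ → (X →L[ℂ] X)} (hc : ContinuousOn g (Set.Ici 0))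
    (hb : BddAbove (Set.range fun τ : Set.Ici (0:ℝ) => Real.exp (τ : ℝ) * ‖g (τ : ℝ)‖)) :
    ∃ G : ℝ → (X →L[ℂ] X), (∀ τ, 0 ≤ τ → HasDerivAt G (g (max τ 0)) τ) ∧
      (∀ τ, 0 ≤ τ → G τ - G 0 = ∫ σ in (0:ℝ)..τ, g σ) ∧
      (∀ τ, 0 ≤ τ → ‖G τ‖ ≤ flatSup g * Real.exp (-τ)) := by
  set g' : ℝ → (X →L[ℂ] X) := fun τ => g (max τ 0) with hg'
  have hcont : Continuous g' :=
    hc.comp_continuous (by fun_prop) (fun τ => Set.mem_Ici.2 (le_max_right _ _))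
  have hle : ∀ τ, 0 ≤ τ → ‖g' τ‖ ≤ flatSup g * Real.exp (-τ) := by
    intro τ hτ
    simp only [hg', max_eq_left hτ]
    exact flat_le hb hτ
  have hmaj : ∀ τ : ℝ, IntegrableOn (fun x : ℝ => flatSup g * Real.exp (-x)) (Set.Ioi τ) :=
    fun τ => (integrableOn_exp_neg_Ioi τ).const_mul _
  have hae : ∀ τ : ℝ, 0 ≤ τ → ∀ᵐ x ∂(volume.restrict (Set.Ioi τ)),
      ‖g' x‖ ≤ flatSup g * Real.exp (-x) := by
    intro τ hτ
    filter_upwards [ae_restrict_mem measurableSet_Ioi] with x hx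
    exact hle x (hτ.trans (le_of_lt hx))
  have hint : ∀ τ : ℝ, 0 ≤ τ → IntegrableOn g' (Set.Ioi τ) := fun τ hτ =>
    (hmaj τ).mono' hcont.aestronglyMeasurable (hae τ hτ)
  refine ⟨fun τ => (∫ σ in (0:ℝ)..τ, g' σ) - ∫ σ in Set.Ioi 0, g' σ, ?_, ?_, ?_⟩
  · intro τ _
    exact (hcont.integral_hasStrictDerivAt 0 τ).hasDerivAt.sub_const _
  · intro τ hτ
    simp only [intervalIntegral.integral_same, zero_sub, sub_neg_eq_add, sub_add_cancel]
    refine intervalIntegral.integral_congr (fun x hx => ?_)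
    rw [Set.uIcc_of_le hτ] at hx
    simp only [hg', max_eq_left hx.1]
  · intro τ hτ
    have h1 := intervalIntegral.integral_interval_add_Ioi (hint 0 le_rfl) (hint τ hτ)
    have h2 : (∫ σ in (0:ℝ)..τ, g' σ) - ∫ σ in Set.Ioi 0, g' σ = - ∫ σ in Set.Ioi τ, g' σ := by
      rw [← h1]; abel
    simp only [h2, norm_neg]
    refine (norm_integral_le_of_norm_le (hmaj τ) (hae τ hτ)).trans ?_
    rw [integral_const_mul, integral_exp_neg_Ioi]

lemma sharp_integral {r : ℕ} (ω : Fin r → ℝ) {f : (Fin r → ℤ) → (X →L[ℂ] X)}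
    (h : Summable fun α => ‖f α‖) (T : ℝ) :
    ∫ σ in (0:ℝ)..T, sharpSum ω f σ =
      ∑' α, (∫ σ in (0:ℝ)..T, Complex.exp (Complex.I * (dotIdx ω α : ℂ) * (σ : ℂ))) • f α := by
  have hd : ∀ τ : ℝ, HasDerivAt (fun T : ℝ =>
      ∑' α, (∫ σ in (0:ℝ)..T, Complex.exp (Complex.I * (dotIdx ω α : ℂ) * (σ : ℂ))) • f α)
      (sharpSum ω f τ) τ := by
    intro τ
    refine hasDerivAt_tsum (y₀ := (0:ℝ)) (g' := fun α (τ : ℝ) =>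
      Complex.exp (Complex.I * (dotIdx ω α : ℂ) * (τ : ℂ)) • f α)
      h (fun α y => ?_) (fun α y => ?_) ?_ τ
    · have hc : Continuous fun σ : ℝ =>
        Complex.exp (Complex.I * (dotIdx ω α : ℂ) * (σ : ℂ)) := by fun_prop
      exact (hc.integral_hasStrictDerivAt 0 y).hasDerivAt.smul_const (f α)
    · rw [norm_smul, norm_expIdx, one_mul]
    · simpa using summable_zero
  rw [intervalIntegral.integral_eq_sub_of_hasDerivAt (fun x _ => hd x)
    ((continuous_sharpSum ω h).intervalIntegrable _ _)]
  simp

lemma timeAvg_sharp {r : ℕ} (ω : Fin r → ℝ) (hω : ∀ α : Fin r → ℤ, α ≠ 0 → dotIdx ω α ≠ 0)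
    {f : (Fin r → ℤ) → (X →L[ℂ] X)} (h : Summable fun α => ‖f α‖) :
    HasTimeAvg (sharpSum ω f) (f 0) := by
  unfold HasTimeAvg
  have key : Tendsto (fun T : ℝ => ∑' α : Fin r → ℤ, ((1 / T) •
      (∫ σ in (0:ℝ)..T, Complex.exp (Complex.I * (dotIdx ω α : ℂ) * (σ : ℂ))) • f α)) atTop
      (nhds (∑' α : Fin r → ℤ, if α = 0 then f 0 else 0)) := by
    refine tendsto_tsum_of_dominated_convergence h (fun α => ?_) ?_
    · by_cases hα : α = 0
      · subst hα
        have h0 : dotIdx ω 0 = 0 := by simp [dotIdx]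
        simp only [if_true]
        refine tendsto_const_nhds.congr' ?_
        filter_upwards [eventually_gt_atTop 0] with T hT
        simp [h0]
        rw [smul_smul, inv_mul_cancel₀ hT.ne', one_smul]
      · simp only [hα, if_false]
        have hc : Complex.I * (dotIdx ω α : ℂ) ≠ 0 := by simp [hω α hα]
        refine squeeze_zero_norm' (a := fun T : ℝ =>
          T⁻¹ * (2 / ‖Complex.I * (dotIdx ω α : ℂ)‖ * ‖f α‖)) ?_ ?_
        · filter_upwards [eventually_gt_atTop 0] with T hT
          rw [integral_exp_mul_complex hc, norm_smul, norm_smul, Real.norm_eq_abs,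
            abs_of_pos (by positivity : 0 < 1 / T), one_div, norm_div]
          gcongr
          refine (norm_sub_le _ _).trans ?_
          rw [norm_expIdx, norm_expIdx]; norm_num
        · simpa using tendsto_inv_atTop_zero.mul_const
            (2 / ‖Complex.I * (dotIdx ω α : ℂ)‖ * ‖f α‖)
    · filter_upwards [eventually_gt_atTop 0] with T hT α
      rw [norm_smul, norm_smul, Real.norm_eq_abs, abs_of_pos (by positivity : 0 < 1 / T)]
      have : ‖∫ σ in (0:ℝ)..T, Complex.exp (Complex.I * (dotIdx ω α : ℂ) * (σ : ℂ))‖ ≤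
          1 * |T - 0| :=
        intervalIntegral.norm_integral_le_of_norm_le_const fun x _ => (norm_expIdx ω α x).le
      rw [sub_zero, abs_of_pos hT, one_mul] at this
      calc 1 / T * (_ * ‖f α‖) ≤ 1 / T * (T * ‖f α‖) := by gcongr
        _ = ‖f α‖ := by field_simp
  rw [tsum_ite_eq] at key
  refine key.congr (fun T => ?_)
  rw [sharp_integral ω h]
  exact tsum_const_smul'' _

lemma timeAvg_sharpFlat {r : ℕ} (ω : Fin r → ℝ)
    (hω : ∀ α : Fin r → ℤ, α ≠ 0 → dotIdx ω α ≠ 0) {κ : ℝ} (hκ : 0 ≤ κ)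
    {φ : ℝ → (X →L[ℂ] X)} {f : (Fin r → ℤ) → (X →L[ℂ] X)} {g : ℝ → (X →L[ℂ] X)}
    (h : IsSharpFlat ω κ φ f g) : HasTimeAvg φ (f 0) := by
  have hs := summable_of_weighted hκ h.summable
  obtain ⟨G, -, hG, hGb⟩ := flat_primitive h.flat_cont h.flat_bdd
  have hM : 0 ≤ flatSup g := Real.iSup_nonneg fun τ => by positivity
  have h2 : Tendsto (fun T : ℝ => (1 / T) • ∫ σ in (0:ℝ)..T, g σ) atTop (nhds 0) := by
    refine squeeze_zero_norm' (a := fun T : ℝ => T⁻¹ * (2 * flatSup g)) ?_ ?_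
    · filter_upwards [eventually_gt_atTop 0] with T hT
      rw [← hG T hT.le, norm_smul, Real.norm_eq_abs, abs_of_pos (by positivity : 0 < 1 / T),
        one_div]
      gcongr
      have a1 := hGb T hT.le
      have a2 := hGb 0 le_rfl
      have a3 : Real.exp (-T) ≤ 1 := Real.exp_le_one_iff.2 (by linarith)
      have a4 := norm_sub_le (G T) (G 0)
      simp only [neg_zero, Real.exp_zero, mul_one] at a2
      nlinarith
    · simpa using tendsto_inv_atTop_zero.mul_const (2 * flatSup g)
  have h3 := (timeAvg_sharp ω hω hs).add h2
  rw [add_zero] at h3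
  refine h3.congr' ?_
  filter_upwards [eventually_gt_atTop 0] with T hT
  rw [← smul_add, ← intervalIntegral.integral_add]
  · congr 1
    refine intervalIntegral.integral_congr (fun x hx => ?_)
    rw [Set.uIcc_of_le hT.le] at hx
    exact (h.decomp x hx.1).symm
  · exact (continuous_sharpSum ω hs).intervalIntegrable _ _
  · refine ContinuousOn.intervalIntegrable (h.flat_cont.mono ?_)
    rw [Set.uIcc_of_le hT.le]
    exact Set.Icc_subset_Ici_self

/-- integration lemma. Under the Diophantine condition, if `ψ` is
sharp-flat of class `κ₊` with time average `⟨ψ⟩ = ψavg`, and `φ` solves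
`∂_τ φ = ψ − ⟨ψ⟩` on `[0,∞)`, then `φ` is sharp-flat of class `κ₋` (in particular
its time average exists, and equals its zero-mode coefficient), with
`𝒩_{κ₋}(φ − ⟨φ⟩) ≤ c_I(κ₊ − κ₋) 𝒩_{κ₊}(ψ − ⟨ψ⟩)`. -/
theorem integration_lemma
    {r : ℕ} (ω : Fin r → ℝ) (c_D ν : ℝ) (hcD : 0 < c_D) (hν : 0 < ν)
    (hdio : ∀ α : Fin r → ℤ, α ≠ 0 → c_D / (absIdx α) ^ ν ≤ |dotIdx ω α|)
    {κm κp : ℝ} (h0 : 0 ≤ κm) (hκ : κm < κp)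
    (ψ : ℝ → (X →L[ℂ] X))
    (ψhat : (Fin r → ℤ) → (X →L[ℂ] X)) (ψflat : ℝ → (X →L[ℂ] X))
    (hψ : IsSharpFlat ω κp ψ ψhat ψflat)
    (ψavg : X →L[ℂ] X) (havg : HasTimeAvg ψ ψavg)
    (φ : ℝ → (X →L[ℂ] X))
    (hφder : ∀ τ : ℝ, 0 ≤ τ → HasDerivWithinAt φ (ψ τ - ψavg) (Set.Ici 0) τ) :
    ∃ (φhat : (Fin r → ℤ) → (X →L[ℂ] X)) (φflat : ℝ → (X →L[ℂ] X)),
      IsSharpFlat ω κm φ φhat φflat ∧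
      HasTimeAvg φ (φhat 0) ∧
      SFNorm κm (fun α => if α = 0 then 0 else φhat α) φflat ≤
        cI c_D ν (κp - κm) *
          SFNorm κp (fun α => if α = 0 then ψhat 0 - ψavg else ψhat α) ψflat := by
  have hω : ∀ α : Fin r → ℤ, α ≠ 0 → 0 < |dotIdx ω α| := fun α hα =>
    lt_of_lt_of_le (div_pos hcD (Real.rpow_pos_of_pos (absIdx_pos α hα) _)) (hdio α hα)
  have hω0 : ∀ α : Fin r → ℤ, α ≠ 0 → dotIdx ω α ≠ 0 := fun α hα => abs_pos.1 (hω α hα)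
  have hp : 0 ≤ κp := h0.trans hκ.le
  have hδ : 0 < κp - κm := sub_pos.2 hκ
  have hψ0 : ψhat 0 = ψavg :=
    tendsto_nhds_unique (timeAvg_sharpFlat ω hω0 hp hψ) havg
  have hψs := summable_of_weighted hp hψ.summable
  set C := cI c_D ν (κp - κm) with hC
  have hC1 : 1 ≤ C := le_max_left _ _
  have hC2 : (1 / c_D) * (ν / ((κp - κm) * Real.exp 1)) ^ ν ≤ C := le_max_right _ _
  -- nonzero modes
  set f : (Fin r → ℤ) → (X →L[ℂ] X) := fun α =>
    if α = 0 then 0 else (Complex.I * (dotIdx ω α : ℂ))⁻¹ • ψhat α with hf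
  set p : (Fin r → ℤ) → (X →L[ℂ] X) := fun α =>
    if α = 0 then ψhat 0 - ψavg else ψhat α with hpdef
  have hp0 : p 0 = 0 := by simp [hpdef, hψ0]
  have hple : ∀ α, ‖p α‖ ≤ ‖ψhat α‖ := by
    intro α
    by_cases hα : α = 0
    · subst hα; simp [hp0]
    · simp [hpdef, hα]
  have hpw : Summable fun α : Fin r → ℤ => Real.exp (κp * absIdx α) * ‖p α‖ :=
    Summable.of_nonneg_of_le (fun _ => by positivity)
      (fun α => mul_le_mul_of_nonneg_left (hple α) (Real.exp_pos _).le) hψ.summable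
  have hfp : ∀ α, Real.exp (κm * absIdx α) * ‖f α‖ ≤
      C * (Real.exp (κp * absIdx α) * ‖p α‖) := by
    intro α
    by_cases hα : α = 0
    · subst hα; simp [hf, hp0]
    · have e1 : ‖f α‖ = |dotIdx ω α|⁻¹ * ‖ψhat α‖ := by
        simp [hf, hα, norm_smul]
      have e2 : ‖p α‖ = ‖ψhat α‖ := by simp [hpdef, hα]
      have hx := absIdx_pos α hα
      have e3 : |dotIdx ω α|⁻¹ ≤ C * Real.exp ((κp - κm) * absIdx α) := by
        calc |dotIdx ω α|⁻¹ ≤ (c_D / absIdx α ^ ν)⁻¹ :=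
              inv_anti₀ (div_pos hcD (Real.rpow_pos_of_pos hx _)) (hdio α hα)
          _ = 1 / c_D * absIdx α ^ ν := by rw [inv_div]; ring
          _ ≤ 1 / c_D * ((ν / ((κp - κm) * Real.exp 1)) ^ ν *
                Real.exp ((κp - κm) * absIdx α)) := by
              gcongr; exact rpow_le_aux hν hδ hx.le
          _ = (1 / c_D * (ν / ((κp - κm) * Real.exp 1)) ^ ν) *
                Real.exp ((κp - κm) * absIdx α) := by ring
          _ ≤ _ := by gcongr
      rw [e1, e2]
      calc Real.exp (κm * absIdx α) * (|dotIdx ω α|⁻¹ * ‖ψhat α‖)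
          ≤ Real.exp (κm * absIdx α) * (C * Real.exp ((κp - κm) * absIdx α) * ‖ψhat α‖) := by
            gcongr
        _ = C * ((Real.exp (κm * absIdx α) * Real.exp ((κp - κm) * absIdx α)) * ‖ψhat α‖) := by
            ring
        _ = _ := by rw [← Real.exp_add]; ring_nf
  have hfw : Summable fun α : Fin r → ℤ => Real.exp (κm * absIdx α) * ‖f α‖ :=
    Summable.of_nonneg_of_le (fun _ => by positivity) hfp (hpw.mul_left C)
  have hfs := summable_of_weighted h0 hfw
  have hps := summable_of_weighted hp hpw
  -- derivative of the sharp part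
  have hfd : ∀ τ, HasDerivAt (sharpSum ω f) (sharpSum ω p τ) τ := by
    intro τ
    unfold sharpSum
    refine hasDerivAt_tsum (y₀ := (0:ℝ))
      (g := fun α (τ : ℝ) => Complex.exp (Complex.I * (dotIdx ω α : ℂ) * (τ : ℂ)) • f α)
      (g' := fun α (τ : ℝ) => Complex.exp (Complex.I * (dotIdx ω α : ℂ) * (τ : ℂ)) • p α)
      hps (fun α y => ?_) (fun α y => ?_) (summable_sharp ω hfs 0) τ
    · by_cases hα : α = 0
      · subst hα
        simp only [hp0, smul_zero]
        simpa [hf] using hasDerivAt_const y (0 : X →L[ℂ] X)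
      · have hc : Complex.I * (dotIdx ω α : ℂ) ≠ 0 := by simp [hω0 α hα]
        have d1 : HasDerivAt (fun t : ℝ => Complex.exp (Complex.I * (dotIdx ω α : ℂ) * (t : ℂ)))
            (Complex.exp (Complex.I * (dotIdx ω α : ℂ) * (y : ℂ)) *
              (Complex.I * (dotIdx ω α : ℂ) * 1)) y :=
          ((Complex.ofRealCLM.hasDerivAt (x := y)).const_mul _).cexp
        have d2 := d1.smul_const (f α)
        have e : (Complex.exp (Complex.I * (dotIdx ω α : ℂ) * (y : ℂ)) *
              (Complex.I * (dotIdx ω α : ℂ) * 1)) • f α =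
            Complex.exp (Complex.I * (dotIdx ω α : ℂ) * (y : ℂ)) • p α := by
          simp only [hpdef, hf, hα, if_false, smul_smul]
          rw [mul_one, mul_assoc, mul_inv_cancel₀ hc, mul_one]
        rw [e] at d2
        exact d2
    · rw [norm_smul, norm_expIdx, one_mul]
  have hpsum : ∀ τ, sharpSum ω ψhat τ = ψavg + sharpSum ω p τ := by
    intro τ
    have e : ∀ α : Fin r → ℤ, Complex.exp (Complex.I * (dotIdx ω α : ℂ) * (τ : ℂ)) • ψhat α =
        (if α = 0 then ψavg else 0) +
          Complex.exp (Complex.I * (dotIdx ω α : ℂ) * (τ : ℂ)) • p α := by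
      intro α
      by_cases hα : α = 0
      · subst hα
        have : dotIdx ω 0 = 0 := by simp [dotIdx]
        simp [hp0, hψ0, this]
      · simp [hpdef, hα]
    unfold sharpSum
    rw [tsum_congr e, Summable.tsum_add (hasSum_ite_eq _ _).summable (summable_sharp ω hps τ),
      tsum_ite_eq]
  obtain ⟨G, hGd, -, hGb⟩ := flat_primitive hψ.flat_cont hψ.flat_bdd
  set F : ℝ → (X →L[ℂ] X) := fun τ => φ τ - (sharpSum ω f τ + G τ) with hF
  have hFd : ∀ τ, 0 ≤ τ → HasDerivWithinAt F 0 (Set.Ici 0) τ := by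
    intro τ hτ
    have d := (hφder τ hτ).sub (((hfd τ).add (hGd τ hτ)).hasDerivWithinAt (s := Set.Ici 0))
    have e : ψ τ - ψavg - (sharpSum ω p τ + ψflat (max τ 0)) = 0 := by
      rw [hψ.decomp τ hτ, hpsum, max_eq_left hτ]
      abel
    rw [e] at d
    exact d
  have hFc : ∀ τ, 0 ≤ τ → F τ = F 0 := by
    intro τ hτ
    refine constant_of_has_deriv_right_zero (a := 0) (b := τ) ?_ ?_ τ ⟨hτ, le_rfl⟩
    · exact fun x hx => ((hFd x hx.1).continuousWithinAt).mono Set.Icc_subset_Ici_self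
    · exact fun x hx => (hFd x hx.1).mono (Set.Ici_subset_Ici.2 hx.1)
  set c := F 0 with hc
  have hif : (fun α : Fin r → ℤ => if α = 0 then (0 : X →L[ℂ] X) else
      (if α = 0 then c else f α)) = f := by
    funext α
    by_cases hα : α = 0
    · simp [hα, hf]
    · simp [hα]
  have hSF : IsSharpFlat ω κm φ (fun α => if α = 0 then c else f α) G := by
    refine ⟨?_, fun τ hτ => (hGd τ hτ).continuousAt.continuousWithinAt, ?_, ?_⟩
    · have e : ∀ α : Fin r → ℤ, Real.exp (κm * absIdx α) * ‖if α = 0 then c else f α‖ =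
          (if α = 0 then ‖c‖ else 0) + Real.exp (κm * absIdx α) * ‖f α‖ := by
        intro α
        by_cases hα : α = 0
        · subst hα; simp [hf, absIdx]
        · simp [hα]
      simp only [e]
      exact (hasSum_ite_eq _ _).summable.add hfw
    · refine ⟨flatSup ψflat, ?_⟩
      rintro _ ⟨⟨τ, hτ⟩, rfl⟩
      have := hGb τ hτ
      rw [Real.exp_neg, ← div_eq_mul_inv, le_div_iff₀ (Real.exp_pos _), mul_comm] at this
      exact this
    · intro τ hτ
      have e : ∀ α : Fin r → ℤ, Complex.exp (Complex.I * (dotIdx ω α : ℂ) * (τ : ℂ)) •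
            (if α = 0 then c else f α) =
          (if α = 0 then c else 0) +
            Complex.exp (Complex.I * (dotIdx ω α : ℂ) * (τ : ℂ)) • f α := by
        intro α
        by_cases hα : α = 0
        · subst hα
          have : dotIdx ω 0 = 0 := by simp [dotIdx]
          simp [hf, this]
        · simp [hα]
      have e2 : sharpSum ω (fun α => if α = 0 then c else f α) τ = c + sharpSum ω f τ := by
        unfold sharpSum
        rw [tsum_congr e, Summable.tsum_add (hasSum_ite_eq _ _).summable
          (summable_sharp ω hfs τ), tsum_ite_eq]
      rw [e2, ← hFc τ hτ]
      simp only [hF]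
      abel
  refine ⟨fun α => if α = 0 then c else f α, G, hSF, timeAvg_sharpFlat ω hω0 h0 hSF, ?_⟩
  rw [hif]
  unfold SFNorm sharpNorm
  rw [mul_add]
  refine add_le_add ?_ ?_
  · rw [← tsum_mul_left]
    exact hfw.tsum_le_tsum hfp (hpw.mul_left C)
  · have hM : 0 ≤ flatSup ψflat := Real.iSup_nonneg fun τ => by positivity
    refine le_trans (ciSup_le ?_) (le_mul_of_one_le_left hM hC1)
    rintro ⟨τ, hτ⟩
    have := hGb τ hτ
    rw [Real.exp_neg, ← div_eq_mul_inv, le_div_iff₀ (Real.exp_pos _), mul_comm] at this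
    exact this
end
end

section
/- Assume ω ∈ ℝ^r is nonresonant (α·ω = 0 implies α = 0 for α ∈ ℤ^r). Let κ ≥ 0, M > 0, c ∈ (0,1). Let a : [0,∞) → End(X) be sharp-flat of class κ with 𝒩_κ(a) ≤ M, and let φ, φ̃ : [0,∞) → End(X) be sharp-flat of class κ with 𝒩_κ(φ − id) ≤ c and 𝒩_κ(φ̃ − id) ≤ c, where id denotes the constant map equal to the identity operator. Then, with Λ{φ}_τ := a_τ φ_τ − φ_τ ⟨aφ⟩ and Λ{φ̃}_τ := a_τ φ̃_τ − φ̃_τ ⟨aφ̃⟩, the Lipschitz estimate 𝒩_κ(Λ{φ} − Λ{φ̃}) ≤ (3+2c) M · 𝒩_κ(φ − φ̃) holds. -/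
open scoped BigOperators
open Filter MeasureTheory

noncomputable section

variable {X : Type*} [NormedAddCommGroup X] [NormedSpace ℂ X] [CompleteSpace X]

section Helpers

set_option linter.unusedSectionVars false
set_option maxHeartbeats 400000

variable {r : ℕ} {ω : Fin r → ℝ} {κ : ℝ}

lemma aux_absIdx_nonneg (α : Fin r → ℤ) : 0 ≤ absIdx α :=
  Finset.sum_nonneg fun _ _ => abs_nonneg _

lemma aux_absIdx_zero : absIdx (0 : Fin r → ℤ) = 0 := by simp [absIdx]

lemma aux_absIdx_tri (α β : Fin r → ℤ) : absIdx α ≤ absIdx β + absIdx (α - β) := by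
  unfold absIdx
  rw [← Finset.sum_add_distrib]
  refine Finset.sum_le_sum fun i _ => ?_
  have h := abs_add_le (β i : ℝ) ((α i : ℝ) - β i)
  simpa using h

lemma aux_dot_add (α β : Fin r → ℤ) : dotIdx ω α = dotIdx ω β + dotIdx ω (α - β) := by
  unfold dotIdx
  rw [← Finset.sum_add_distrib]
  refine Finset.sum_congr rfl fun i _ => ?_
  simp only [Pi.sub_apply]; push_cast; ring

lemma aux_one_le_w (hκ : 0 ≤ κ) (α : Fin r → ℤ) : 1 ≤ Real.exp (κ * absIdx α) :=
  Real.one_le_exp (mul_nonneg hκ (aux_absIdx_nonneg α))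

lemma aux_w_tri (hκ : 0 ≤ κ) (α β : Fin r → ℤ) : Real.exp (κ * absIdx α) ≤
    Real.exp (κ * absIdx β) * Real.exp (κ * absIdx (α - β)) := by
  rw [← Real.exp_add, ← mul_add]
  exact Real.exp_le_exp.2 (mul_le_mul_of_nonneg_left (aux_absIdx_tri α β) hκ)

/-- the phase factor -/
def auxE (ω : Fin r → ℝ) (α : Fin r → ℤ) (τ : ℝ) : ℂ :=
  Complex.exp (Complex.I * (dotIdx ω α : ℂ) * (τ : ℂ))

lemma auxE_norm (α : Fin r → ℤ) (τ : ℝ) : ‖auxE ω α τ‖ = 1 := by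
  unfold auxE
  rw [Complex.norm_exp]; simp

lemma auxE_mul (α β : Fin r → ℤ) (τ : ℝ) : auxE ω α τ = auxE ω β τ * auxE ω (α - β) τ := by
  unfold auxE
  rw [← Complex.exp_add, aux_dot_add α β]
  congr 1; push_cast; ring

lemma auxE_cont (α : Fin r → ℤ) : Continuous (auxE ω α) := by
  unfold auxE; fun_prop

lemma aux_norm_summable (hκ : 0 ≤ κ) {f : (Fin r → ℤ) → (X →L[ℂ] X)}
    (hf : Summable fun α => Real.exp (κ * absIdx α) * ‖f α‖) : Summable fun α => ‖f α‖ :=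
  Summable.of_nonneg_of_le (fun _ => norm_nonneg _)
    (fun α => le_mul_of_one_le_left (norm_nonneg _) (aux_one_le_w hκ α)) hf

lemma aux_sharp_normsummable {f : (Fin r → ℤ) → (X →L[ℂ] X)}
    (hf : Summable fun α => ‖f α‖) (τ : ℝ) : Summable fun α => ‖auxE ω α τ • f α‖ := by
  simpa [norm_smul, auxE_norm] using hf

lemma aux_sharp_hasSum {f : (Fin r → ℤ) → (X →L[ℂ] X)}
    (hf : Summable fun α => ‖f α‖) (τ : ℝ) :
    HasSum (fun α => auxE ω α τ • f α) (sharpSum ω f τ) :=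
  (aux_sharp_normsummable hf τ).of_norm.hasSum

lemma aux_sharpSum_cont {f : (Fin r → ℤ) → (X →L[ℂ] X)}
    (hf : Summable fun α => ‖f α‖) : Continuous (sharpSum ω f) := by
  unfold sharpSum
  refine continuous_tsum (fun α => ?_) hf (fun α τ => ?_)
  · exact (auxE_cont (ω := ω) α).smul continuous_const
  · exact le_of_eq (by rw [norm_smul]; erw [auxE_norm]; simp)

lemma aux_sharpNorm_nonneg (f : (Fin r → ℤ) → (X →L[ℂ] X)) : 0 ≤ sharpNorm κ f :=
  tsum_nonneg fun _ => by positivity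

lemma aux_sharpSum_le (hκ : 0 ≤ κ) {f : (Fin r → ℤ) → (X →L[ℂ] X)}
    (hf : Summable fun α => Real.exp (κ * absIdx α) * ‖f α‖) (τ : ℝ) :
    ‖sharpSum ω f τ‖ ≤ sharpNorm κ f := by
  have h1 := aux_norm_summable hκ hf
  calc ‖sharpSum ω f τ‖ ≤ ∑' α, ‖auxE ω α τ • f α‖ :=
        norm_tsum_le_tsum_norm (aux_sharp_normsummable h1 τ)
    _ ≤ sharpNorm κ f := by
        refine Summable.tsum_le_tsum (fun α => ?_) (aux_sharp_normsummable h1 τ) hf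
        rw [norm_smul, auxE_norm, one_mul]
        exact le_mul_of_one_le_left (norm_nonneg _) (aux_one_le_w hκ α)

lemma aux_coef_le (hκ : 0 ≤ κ) {f : (Fin r → ℤ) → (X →L[ℂ] X)}
    (hf : Summable fun α => Real.exp (κ * absIdx α) * ‖f α‖) (α : Fin r → ℤ) :
    ‖f α‖ ≤ sharpNorm κ f :=
  (le_mul_of_one_le_left (norm_nonneg _) (aux_one_le_w hκ α)).trans
    (hf.le_tsum α fun _ _ => by positivity)

lemma aux_flatSup_nonneg (g : ℝ → (X →L[ℂ] X)) : 0 ≤ flatSup g :=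
  Real.iSup_nonneg fun _ => by positivity

lemma aux_SFNorm_nonneg (f : (Fin r → ℤ) → (X →L[ℂ] X)) (g : ℝ → (X →L[ℂ] X)) :
    0 ≤ SFNorm κ f g := add_nonneg (aux_sharpNorm_nonneg f) (aux_flatSup_nonneg g)

lemma aux_flat_le {g : ℝ → (X →L[ℂ] X)}
    (hg : BddAbove (Set.range fun τ : Set.Ici (0:ℝ) => Real.exp (τ : ℝ) * ‖g (τ : ℝ)‖))
    {τ : ℝ} (hτ : 0 ≤ τ) : Real.exp τ * ‖g τ‖ ≤ flatSup g :=
  le_ciSup hg (⟨τ, hτ⟩ : Set.Ici (0:ℝ))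

lemma aux_flat_bdd {g : ℝ → (X →L[ℂ] X)} {C : ℝ}
    (h : ∀ τ : ℝ, 0 ≤ τ → Real.exp τ * ‖g τ‖ ≤ C) :
    BddAbove (Set.range fun τ : Set.Ici (0:ℝ) => Real.exp (τ : ℝ) * ‖g (τ : ℝ)‖) := by
  refine ⟨C, ?_⟩
  rintro _ ⟨τ, rfl⟩
  exact h τ τ.2

lemma aux_flatSup_le {g : ℝ → (X →L[ℂ] X)} {C : ℝ}
    (h : ∀ τ : ℝ, 0 ≤ τ → Real.exp τ * ‖g τ‖ ≤ C) : flatSup g ≤ C := by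
  have : Nonempty (Set.Ici (0:ℝ)) := ⟨⟨0, Set.mem_Ici.2 (le_refl _)⟩⟩
  exact ciSup_le fun τ => h τ τ.2

lemma aux_mk {φ : ℝ → (X →L[ℂ] X)} {f : (Fin r → ℤ) → (X →L[ℂ] X)} {g : ℝ → (X →L[ℂ] X)} {C : ℝ}
    (h1 : Summable fun α : Fin r → ℤ => Real.exp (κ * absIdx α) * ‖f α‖)
    (h2 : ContinuousOn g (Set.Ici 0)) (h3 : ∀ τ : ℝ, 0 ≤ τ → Real.exp τ * ‖g τ‖ ≤ C)
    (h4 : ∀ τ : ℝ, 0 ≤ τ → φ τ = sharpSum ω f τ + g τ) : IsSharpFlat ω κ φ f g := by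
  have h5 := aux_flat_bdd h3
  exact IsSharpFlat.mk h1 h2 h5 h4

/-- differences -/
lemma aux_sub (hκ : 0 ≤ κ) {φ ψ : ℝ → (X →L[ℂ] X)} {f f' : (Fin r → ℤ) → (X →L[ℂ] X)}
    {g g' : ℝ → (X →L[ℂ] X)} (h : IsSharpFlat ω κ φ f g) (h' : IsSharpFlat ω κ ψ f' g') :
    IsSharpFlat ω κ (fun τ => φ τ - ψ τ) (fun α => f α - f' α) (fun τ => g τ - g' τ) ∧
    SFNorm κ (fun α => f α - f' α) (fun τ => g τ - g' τ) ≤ SFNorm κ f g + SFNorm κ f' g' := by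
  have hle : ∀ α : Fin r → ℤ, Real.exp (κ * absIdx α) * ‖f α - f' α‖ ≤
      Real.exp (κ * absIdx α) * ‖f α‖ + Real.exp (κ * absIdx α) * ‖f' α‖ := fun α => by
    rw [← mul_add]
    exact mul_le_mul_of_nonneg_left (norm_sub_le _ _) (Real.exp_pos _).le
  have hfl : ∀ τ : ℝ, 0 ≤ τ → Real.exp τ * ‖g τ - g' τ‖ ≤ flatSup g + flatSup g' := fun τ hτ => by
    refine le_trans ?_ (add_le_add (aux_flat_le h.flat_bdd hτ) (aux_flat_le h'.flat_bdd hτ))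
    rw [← mul_add]
    exact mul_le_mul_of_nonneg_left (norm_sub_le _ _) (Real.exp_pos _).le
  have hs : Summable fun α : Fin r → ℤ => Real.exp (κ * absIdx α) * ‖f α - f' α‖ :=
    Summable.of_nonneg_of_le (fun _ => by positivity) hle (h.summable.add h'.summable)
  refine ⟨aux_mk hs (h.flat_cont.sub h'.flat_cont) hfl (fun τ hτ => ?_), ?_⟩
  · have e : sharpSum ω (fun α => f α - f' α) τ = sharpSum ω f τ - sharpSum ω f' τ := by
      refine (aux_sharp_hasSum (aux_norm_summable hκ hs) τ).unique ?_
      have := (aux_sharp_hasSum (ω := ω) (aux_norm_summable hκ h.summable) τ).sub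
        (aux_sharp_hasSum (ω := ω) (aux_norm_summable hκ h'.summable) τ)
      simpa only [smul_sub] using this
    rw [h.decomp τ hτ, h'.decomp τ hτ, e]; abel
  · have h1 : sharpNorm κ (fun α => f α - f' α) ≤ sharpNorm κ f + sharpNorm κ f' := by
      unfold sharpNorm
      rw [← h.summable.tsum_add h'.summable]
      exact hs.tsum_le_tsum hle (h.summable.add h'.summable)
    have h2 := aux_flatSup_le hfl
    unfold SFNorm; linarith

/-- constants -/
lemma aux_const (B : X →L[ℂ] X) :
    IsSharpFlat ω κ (fun _ => B) (fun α => if α = 0 then B else 0) (fun _ => 0) ∧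
    SFNorm κ (fun α : Fin r → ℤ => if α = 0 then B else 0) (fun _ => 0) = ‖B‖ := by
  have h0 : ∀ α : Fin r → ℤ, α ≠ 0 →
      Real.exp (κ * absIdx α) * ‖(if α = 0 then B else 0 : X →L[ℂ] X)‖ = 0 := by
    intro α hα; simp [hα]
  have hs := hasSum_single (0 : Fin r → ℤ) h0
  refine ⟨aux_mk hs.summable continuousOn_const (C := 0) (by simp) (fun τ _ => ?_), ?_⟩
  · unfold sharpSum
    rw [tsum_eq_single (0 : Fin r → ℤ) (by intro α hα; simp [hα])]
    simp [dotIdx]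
  · unfold SFNorm sharpNorm flatSup
    rw [hs.tsum_eq]
    simp [aux_absIdx_zero]

/-- convolution of coefficient families -/
def auxConv (f f' : (Fin r → ℤ) → (X →L[ℂ] X)) (α : Fin r → ℤ) : X →L[ℂ] X :=
  ∑' β, f β * f' (α - β)

/-- the change of variables -/
def auxEquiv (r : ℕ) : (Fin r → ℤ) × (Fin r → ℤ) ≃ (Fin r → ℤ) × (Fin r → ℤ) where
  toFun p := (p.2, p.1 - p.2)
  invFun p := (p.1 + p.2, p.1)
  left_inv p := by ext <;> simp
  right_inv p := by ext <;> simp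

lemma aux_conv_summable {f f' : (Fin r → ℤ) → (X →L[ℂ] X)}
    (h : Summable fun α => ‖f α‖) (h' : Summable fun α => ‖f' α‖) (α : Fin r → ℤ) :
    Summable fun β => ‖f β * f' (α - β)‖ := by
  have h1 : Summable fun p : (Fin r → ℤ) × (Fin r → ℤ) => ‖f p.1 * f' p.2‖ := h.mul_norm h'
  have h2 := (auxEquiv r).summable_iff.2 h1
  exact h2.prod_factor α

lemma aux_conv_sharp (hκ : 0 ≤ κ) {f f' : (Fin r → ℤ) → (X →L[ℂ] X)}
    (h : Summable fun α => Real.exp (κ * absIdx α) * ‖f α‖)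
    (h' : Summable fun α => Real.exp (κ * absIdx α) * ‖f' α‖) :
    (Summable fun α => Real.exp (κ * absIdx α) * ‖auxConv f f' α‖) ∧
    sharpNorm κ (auxConv f f') ≤ sharpNorm κ f * sharpNorm κ f' ∧
    ∀ τ, sharpSum ω (auxConv f f') τ = sharpSum ω f τ * sharpSum ω f' τ := by
  have n := aux_norm_summable hκ h
  have n' := aux_norm_summable hκ h'
  have hp := h.mul_of_nonneg h' (fun _ => by positivity) (fun _ => by positivity)
  have hq := (auxEquiv r).summable_iff.2 hp
  have hle : ∀ α : Fin r → ℤ, Real.exp (κ * absIdx α) * ‖auxConv f f' α‖ ≤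
      ∑' β, (Real.exp (κ * absIdx β) * ‖f β‖) *
        (Real.exp (κ * absIdx (α - β)) * ‖f' (α - β)‖) := by
    intro α
    have hs := aux_conv_summable n n' α
    calc _ ≤ Real.exp (κ * absIdx α) * ∑' β, ‖f β * f' (α - β)‖ :=
          mul_le_mul_of_nonneg_left (norm_tsum_le_tsum_norm hs) (Real.exp_pos _).le
      _ = ∑' β, Real.exp (κ * absIdx α) * ‖f β * f' (α - β)‖ := tsum_mul_left.symm
      _ ≤ _ := by
          refine (hs.mul_left _).tsum_le_tsum (fun β => ?_) (hq.prod_factor α)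
          calc _ ≤ (Real.exp (κ * absIdx β) * Real.exp (κ * absIdx (α - β))) *
                (‖f β‖ * ‖f' (α - β)‖) := by
                gcongr
                · exact aux_w_tri hκ α β
                · exact norm_mul_le _ _
            _ = _ := by ring
  have hs : Summable fun α => Real.exp (κ * absIdx α) * ‖auxConv f f' α‖ :=
    Summable.of_nonneg_of_le (fun _ => by positivity) hle hq.prod
  refine ⟨hs, ?_, fun τ => ?_⟩
  · calc sharpNorm κ (auxConv f f') ≤ _ := hs.tsum_le_tsum hle hq.prod
      _ = _ := hq.tsum_prod.symm
      _ = _ := (auxEquiv r).tsum_eq (fun p : (Fin r → ℤ) × (Fin r → ℤ) =>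
          (Real.exp (κ * absIdx p.1) * ‖f p.1‖) * (Real.exp (κ * absIdx p.2) * ‖f' p.2‖))
      _ = _ := (h.tsum_mul_tsum h' hp).symm
  · have s := aux_sharp_normsummable (ω := ω) n τ
    have s' := aux_sharp_normsummable (ω := ω) n' τ
    have P := (s.mul_norm s').of_norm
    have Q := (auxEquiv r).summable_iff.2 P
    symm
    calc sharpSum ω f τ * sharpSum ω f' τ = _ := s.of_norm.tsum_mul_tsum s'.of_norm P
      _ = _ := ((auxEquiv r).tsum_eq (fun p : (Fin r → ℤ) × (Fin r → ℤ) =>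
          (auxE ω p.1 τ • f p.1) * (auxE ω p.2 τ • f' p.2))).symm
      _ = _ := Q.tsum_prod
      _ = _ := by
        refine tsum_congr fun α => ?_
        change _ = auxE ω α τ • auxConv f f' α
        unfold auxConv
        rw [← (aux_conv_summable n n' α).of_norm.tsum_const_smul]
        refine tsum_congr fun β => ?_
        change (auxE ω β τ • f β) * (auxE ω (α - β) τ • f' (α - β)) = _
        rw [smul_mul_smul_comm, ← auxE_mul]

/-- products -/
lemma aux_mul (hκ : 0 ≤ κ) {φ ψ : ℝ → (X →L[ℂ] X)} {f f' : (Fin r → ℤ) → (X →L[ℂ] X)}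
    {g g' : ℝ → (X →L[ℂ] X)} (h : IsSharpFlat ω κ φ f g) (h' : IsSharpFlat ω κ ψ f' g') :
    ∃ G, IsSharpFlat ω κ (fun τ => φ τ * ψ τ) (auxConv f f') G ∧
    SFNorm κ (auxConv f f') G ≤ SFNorm κ f g * SFNorm κ f' g' := by
  obtain ⟨c1, c2, c3⟩ := aux_conv_sharp (ω := ω) hκ h.summable h'.summable
  have n := aux_norm_summable hκ h.summable
  have n' := aux_norm_summable hκ h'.summable
  have hfl : ∀ τ : ℝ, 0 ≤ τ → Real.exp τ *
      ‖sharpSum ω f τ * g' τ + g τ * sharpSum ω f' τ + g τ * g' τ‖ ≤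
      sharpNorm κ f * flatSup g' + flatSup g * sharpNorm κ f' + flatSup g * flatSup g' := by
    intro τ hτ
    have a1 := aux_sharpSum_le (ω := ω) hκ h.summable τ
    have a2 := aux_sharpSum_le (ω := ω) hκ h'.summable τ
    have b1 := aux_flat_le h.flat_bdd hτ
    have b2 := aux_flat_le h'.flat_bdd hτ
    have e1 := Real.one_le_exp hτ
    have b3 : ‖g' τ‖ ≤ flatSup g' := (le_mul_of_one_le_left (norm_nonneg _) e1).trans b2
    have p := Real.exp_pos τ
    calc _ ≤ Real.exp τ * (‖sharpSum ω f τ‖ * ‖g' τ‖ + ‖g τ‖ * ‖sharpSum ω f' τ‖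
            + ‖g τ‖ * ‖g' τ‖) := by
          refine mul_le_mul_of_nonneg_left ?_ p.le
          refine (norm_add₃_le).trans ?_
          gcongr <;> exact norm_mul_le _ _
      _ = ‖sharpSum ω f τ‖ * (Real.exp τ * ‖g' τ‖) + (Real.exp τ * ‖g τ‖) * ‖sharpSum ω f' τ‖
            + (Real.exp τ * ‖g τ‖) * ‖g' τ‖ := by ring
      _ ≤ _ := by
          have := aux_flatSup_nonneg g
          have := aux_sharpNorm_nonneg (κ := κ) f
          gcongr
  refine ⟨fun τ => sharpSum ω f τ * g' τ + g τ * sharpSum ω f' τ + g τ * g' τ,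
    aux_mk c1 ?_ hfl (fun τ hτ => ?_), ?_⟩
  · have k := (aux_sharpSum_cont (ω := ω) n).continuousOn (s := Set.Ici 0)
    have k' := (aux_sharpSum_cont (ω := ω) n').continuousOn (s := Set.Ici 0)
    exact ((k.mul h'.flat_cont).add (h.flat_cont.mul k')).add (h.flat_cont.mul h'.flat_cont)
  · rw [h.decomp τ hτ, h'.decomp τ hτ, c3]; noncomm_ring
  · have := aux_flatSup_le hfl
    unfold SFNorm
    nlinarith

lemma aux_phase_avg {l : ℝ} (hl : l ≠ 0) :
    Tendsto (fun T : ℝ => ((1 / T : ℝ) : ℂ) *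
      ∫ σ in (0:ℝ)..T, Complex.exp (Complex.I * (l : ℂ) * (σ : ℂ))) atTop (nhds 0) := by
  have hc : Complex.I * (l : ℂ) ≠ 0 := mul_ne_zero Complex.I_ne_zero (by exact_mod_cast hl)
  have hb : ∀ T : ℝ, ‖∫ σ in (0:ℝ)..T, Complex.exp (Complex.I * (l : ℂ) * (σ : ℂ))‖ ≤
      2 / |l| := by
    intro T
    rw [integral_exp_mul_complex hc, norm_div]
    simp only [norm_mul, Complex.norm_I, one_mul, Complex.norm_real, Real.norm_eq_abs]
    gcongr
    refine (norm_sub_le _ _).trans ?_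
    rw [Complex.norm_exp, Complex.norm_exp]; simp; norm_num
  have ht : Tendsto (fun T : ℝ => (1 / T) * (2 / |l|)) atTop (nhds 0) := by
    simpa using (tendsto_inv_atTop_zero (𝕜 := ℝ)).mul_const (2 / |l|)
  refine squeeze_zero_norm' ?_ ht
  filter_upwards [eventually_gt_atTop 0] with T hT
  rw [norm_mul, Complex.norm_real, Real.norm_of_nonneg (by positivity)]
  exact mul_le_mul_of_nonneg_left (hb T) (by positivity)

lemma aux_sharp_avg (hres : ∀ α : Fin r → ℤ, dotIdx ω α = 0 → α = 0)
    {f : (Fin r → ℤ) → (X →L[ℂ] X)} (hf : Summable fun α => ‖f α‖) :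
    HasTimeAvg (sharpSum ω f) (f 0) := by
  have key : ∀ T : ℝ, HasSum (fun α => ∫ σ in (0:ℝ)..T, auxE ω α σ • f α)
      (∫ σ in (0:ℝ)..T, sharpSum ω f σ) := by
    intro T
    refine intervalIntegral.hasSum_integral_of_dominated_convergence (fun α _ => ‖f α‖)
      (fun α => ?_) (fun α => ?_) ?_ ?_ ?_
    · exact (((auxE_cont α).smul continuous_const).aestronglyMeasurable)
    · exact Eventually.of_forall fun σ _ => by rw [norm_smul, auxE_norm, one_mul]
    · exact Eventually.of_forall fun _ _ => hf
    · exact intervalIntegrable_const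
    · exact Eventually.of_forall fun σ _ => aux_sharp_hasSum hf σ
  have e : ∀ T : ℝ, (1 / T) • ∫ σ in (0:ℝ)..T, sharpSum ω f σ =
      ∑' α, (((1 / T : ℝ) : ℂ) * ∫ σ in (0:ℝ)..T, auxE ω α σ) • f α := by
    intro T
    rw [← ((key T).const_smul (1 / T)).tsum_eq]
    refine tsum_congr fun α => ?_
    rw [intervalIntegral.integral_smul_const, mul_smul, Complex.coe_smul]
  have z : f 0 = ∑' α : Fin r → ℤ, (if α = 0 then (1:ℂ) else 0) • f α := by
    rw [tsum_eq_single (0 : Fin r → ℤ) (by intro α hα; simp [hα])]; simp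
  unfold HasTimeAvg
  simp_rw [e]
  rw [z]
  refine tendsto_tsum_of_dominated_convergence hf (fun α => ?_) ?_
  · refine Tendsto.smul_const ?_ _
    by_cases hα : α = 0
    · subst hα
      simp only [if_true]
      refine tendsto_const_nhds.congr' ?_
      filter_upwards [eventually_gt_atTop 0] with T hT
      have : ∀ σ, auxE ω (0 : Fin r → ℤ) σ = 1 := by intro σ; simp [auxE, dotIdx]
      simp only [this]
      simp
      have : (T : ℂ) ≠ 0 := by exact_mod_cast hT.ne'
      field_simp
    · simp only [hα, if_false]
      exact aux_phase_avg fun h => hα (hres α h)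
  · filter_upwards [eventually_gt_atTop 0] with T hT α
    have := intervalIntegral.norm_integral_le_of_norm_le_const (a := 0) (b := T) (C := 1)
      (f := auxE ω α) (fun σ _ => (auxE_norm α σ).le)
    rw [norm_smul, norm_mul, Complex.norm_real, Real.norm_of_nonneg (by positivity)]
    refine mul_le_of_le_one_left (norm_nonneg _) ?_
    rw [sub_zero, abs_of_pos hT, one_mul] at this
    calc _ ≤ 1 / T * T := mul_le_mul_of_nonneg_left this (by positivity)
      _ = 1 := by field_simp

lemma aux_flat_avg {g : ℝ → (X →L[ℂ] X)}
    (hg : BddAbove (Set.range fun τ : Set.Ici (0:ℝ) => Real.exp (τ : ℝ) * ‖g (τ : ℝ)‖)) :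
    HasTimeAvg g 0 := by
  have hb : ∀ T : ℝ, 0 < T → ‖∫ σ in (0:ℝ)..T, g σ‖ ≤ flatSup g := by
    intro T hT
    have h1 : ‖∫ σ in (0:ℝ)..T, g σ‖ ≤ ∫ σ in (0:ℝ)..T, flatSup g * Real.exp (-σ) := by
      refine intervalIntegral.norm_integral_le_of_norm_le hT.le ?_ ?_
      · refine Eventually.of_forall fun σ hσ => ?_
        have := aux_flat_le hg hσ.1.le
        rw [Real.exp_neg, ← div_eq_mul_inv, le_div_iff₀ (Real.exp_pos _)]
        linarith
      · exact (by fun_prop : Continuous fun σ : ℝ => flatSup g * Real.exp (-σ)).intervalIntegrable _ _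
    refine h1.trans ?_
    rw [intervalIntegral.integral_const_mul]
    refine mul_le_of_le_one_right (aux_flatSup_nonneg g) ?_
    rw [intervalIntegral.integral_comp_neg (fun x => Real.exp x), integral_exp]
    simp [(Real.exp_pos _).le]
  have ht : Tendsto (fun T : ℝ => (1 / T) * flatSup g) atTop (nhds 0) := by
    simpa using (tendsto_inv_atTop_zero (𝕜 := ℝ)).mul_const (flatSup g)
  refine squeeze_zero_norm' ?_ ht
  filter_upwards [eventually_gt_atTop 0] with T hT
  rw [norm_smul, Real.norm_of_nonneg (by positivity)]
  exact mul_le_mul_of_nonneg_left (hb T hT) (by positivity)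

lemma aux_avg (hres : ∀ α : Fin r → ℤ, dotIdx ω α = 0 → α = 0) (hκ : 0 ≤ κ)
    {φ : ℝ → (X →L[ℂ] X)} {f : (Fin r → ℤ) → (X →L[ℂ] X)}
    {g : ℝ → (X →L[ℂ] X)} (h : IsSharpFlat ω κ φ f g) : HasTimeAvg φ (f 0) := by
  have n := aux_norm_summable hκ h.summable
  have := (aux_sharp_avg hres n).add (aux_flat_avg h.flat_bdd)
  rw [add_zero] at this
  refine this.congr' ?_
  filter_upwards [eventually_gt_atTop 0] with T hT
  rw [← smul_add, ← intervalIntegral.integral_add]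
  · congr 1
    refine intervalIntegral.integral_congr fun σ hσ => ?_
    rw [Set.uIcc_of_le hT.le] at hσ
    exact (h.decomp σ hσ.1).symm
  · exact (aux_sharpSum_cont n).intervalIntegrable _ _
  · refine ContinuousOn.intervalIntegrable (h.flat_cont.mono ?_)
    rw [Set.uIcc_of_le hT.le]
    exact fun σ hσ => hσ.1

lemma aux_bound (hκ : 0 ≤ κ) {c : ℝ} {φ : ℝ → (X →L[ℂ] X)} {f : (Fin r → ℤ) → (X →L[ℂ] X)}
    {g : ℝ → (X →L[ℂ] X)} (h : IsSharpFlat ω κ φ f g)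
    (hc : SFNorm κ (fun α => if α = 0 then f 0 - 1 else f α) g ≤ c) :
    SFNorm κ f g ≤ 1 + c := by
  have k := aux_const (ω := ω) (κ := κ) (1 : X →L[ℂ] X)
  have k' := aux_const (ω := ω) (κ := κ) (-1 : X →L[ℂ] X)
  have h1 := (aux_sub hκ h k.1).1
  have h2 := (aux_sub hκ h1 k'.1).2
  have e1 : (fun α : Fin r → ℤ => f α - (if α = 0 then 1 else 0)) =
      fun α => if α = 0 then f 0 - 1 else f α := by
    funext α; by_cases hα : α = 0 <;> simp [hα]
  have e2 : (fun α : Fin r → ℤ => f α - (if α = 0 then 1 else 0) - (if α = 0 then -1 else 0)) =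
      f := by
    funext α; by_cases hα : α = 0 <;> simp [hα]
  rw [k'.2, e1, e2] at h2
  simp only [sub_zero] at h2
  have h3 : ‖(-1 : X →L[ℂ] X)‖ ≤ 1 := by
    rw [norm_neg]; exact ContinuousLinearMap.norm_id_le
  change SFNorm κ f g ≤ _ at h2
  linarith

end Helpers

/-- Lipschitz bound on the operator `Λ`. If `a` is sharp-flat of class
`κ` with `𝒩_κ(a) ≤ M` and `φ, φ̃` are sharp-flat of class `κ` with
`𝒩_κ(φ − id) ≤ c` and `𝒩_κ(φ̃ − id) ≤ c`, then `Λ{φ} − Λ{φ̃}` is sharp-flat of class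
`κ` and `𝒩_κ(Λ{φ} − Λ{φ̃}) ≤ (3+2c) M 𝒩_κ(φ − φ̃)`. -/
theorem Lambda_lipschitz
    {r : ℕ} (ω : Fin r → ℝ)
    (hres : ∀ α : Fin r → ℤ, dotIdx ω α = 0 → α = 0)
    {κ : ℝ} (hκ : 0 ≤ κ) (M c : ℝ) (hM : 0 < M) (hc0 : 0 < c) (hc1 : c < 1)
    (a : ℝ → (X →L[ℂ] X))
    (ahat : (Fin r → ℤ) → (X →L[ℂ] X)) (aflat : ℝ → (X →L[ℂ] X))
    (ha : IsSharpFlat ω κ a ahat aflat) (haM : SFNorm κ ahat aflat ≤ M)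
    (φ φt : ℝ → (X →L[ℂ] X))
    (φhat φthat : (Fin r → ℤ) → (X →L[ℂ] X)) (φflat φtflat : ℝ → (X →L[ℂ] X))
    (hφ : IsSharpFlat ω κ φ φhat φflat) (hφt : IsSharpFlat ω κ φt φthat φtflat)
    (hφc : SFNorm κ (fun α => if α = 0 then φhat 0 - 1 else φhat α) φflat ≤ c)
    (hφtc : SFNorm κ (fun α => if α = 0 then φthat 0 - 1 else φthat α) φtflat ≤ c) :
    ∃ B Bt : X →L[ℂ] X,
      HasTimeAvg (fun τ => a τ ∘L φ τ) B ∧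
      HasTimeAvg (fun τ => a τ ∘L φt τ) Bt ∧
      ∃ (Dhat : (Fin r → ℤ) → (X →L[ℂ] X)) (Dflat : ℝ → (X →L[ℂ] X)),
        IsSharpFlat ω κ
          (fun τ => (a τ ∘L φ τ - φ τ ∘L B) - (a τ ∘L φt τ - φt τ ∘L Bt)) Dhat Dflat ∧
        SFNorm κ Dhat Dflat ≤
          (3 + 2 * c) * M *
            SFNorm κ (fun α => φhat α - φthat α) (fun τ => φflat τ - φtflat τ) := by
  have hδ := (aux_sub hκ hφ hφt).1
  have nφ := aux_bound hκ hφ hφc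
  have nφt := aux_bound hκ hφt hφtc
  obtain ⟨G1, p1, q1⟩ := aux_mul hκ ha hφ
  obtain ⟨G2, p2, q2⟩ := aux_mul hκ ha hφt
  obtain ⟨G3, p3, q3⟩ := aux_mul hκ ha hδ
  set B := auxConv ahat φhat 0 with hB
  set Bt := auxConv ahat φthat 0 with hBt
  set δ := SFNorm κ (fun α => φhat α - φthat α) (fun τ => φflat τ - φtflat τ) with hδd
  have δ0 : 0 ≤ δ := aux_SFNorm_nonneg _ _
  have na := aux_norm_summable hκ ha.summable
  have eB : B - Bt = auxConv ahat (fun α => φhat α - φthat α) 0 := by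
    rw [hB, hBt]
    unfold auxConv
    rw [← (aux_conv_summable na (aux_norm_summable hκ hφ.summable) 0).of_norm.tsum_sub
      (aux_conv_summable na (aux_norm_summable hκ hφt.summable) 0).of_norm]
    simp only [mul_sub]
  have bB : ‖B‖ ≤ M * (1 + c) := by
    have h1 := aux_coef_le hκ p1.summable 0
    have h2 : sharpNorm κ (auxConv ahat φhat) ≤ SFNorm κ (auxConv ahat φhat) G1 :=
      le_add_of_nonneg_right (aux_flatSup_nonneg G1)
    refine (h1.trans h2).trans (q1.trans ?_)
    exact mul_le_mul haM nφ (aux_SFNorm_nonneg _ _) hM.le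
  have q3' := q3.trans (mul_le_mul_of_nonneg_right haM δ0)
  have bD : ‖B - Bt‖ ≤ M * δ := by
    rw [eB]
    have h1 := aux_coef_le hκ p3.summable 0
    exact (h1.trans (le_add_of_nonneg_right (aux_flatSup_nonneg G3))).trans q3'
  have kB := aux_const (ω := ω) (κ := κ) B
  have kD := aux_const (ω := ω) (κ := κ) (B - Bt)
  obtain ⟨G4, p4, q4⟩ := aux_mul hκ hδ kB.1
  obtain ⟨G5, p5, q5⟩ := aux_mul hκ hφt kD.1
  obtain ⟨s1, t1⟩ := aux_sub hκ p3 p4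
  obtain ⟨s2, t2⟩ := aux_sub hκ s1 p5
  refine ⟨B, Bt, aux_avg hres hκ p1, aux_avg hres hκ p2, _, _, ?_, t2.trans ?_⟩
  · convert s2 using 2 with τ
    change (a τ * φ τ - φ τ * B) - (a τ * φt τ - φt τ * Bt) = _
    noncomm_ring
  · rw [kB.2] at q4
    rw [kD.2] at q5
    have u4 := q4.trans (mul_le_mul_of_nonneg_left bB δ0)
    have u5 := q5.trans (mul_le_mul nφt bD (norm_nonneg _) (by linarith))
    calc _ ≤ M * δ + δ * (M * (1 + c)) + (1 + c) * (M * δ) := by linarith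
      _ = _ := by ring
end
end
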